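/- Let (S, m) be a commutative Noetherian local ring and M a nonzero finitely generated S-module of finite projective dimension e = pd_S(M). Then there is an isomorphism of S-modules Hom_S(Ext_S^e(M, S), M) ≅ Tor^S_e(M, M). In particular Hom_S(Ext_S^e(M, S), M) ≠ 0 if and only if Tor^S_e(M, M) ≠ 0. -/

import Mathlib

open CategoryTheory Opposite IsLocalRing

universe u

/-- Ext_S^i(M, N) as a module. -/
noncomputable abbrev extMod (S : Type u) [CommRing S] (i : ℕ)
    (M N : Type u) [AddCommGroup M] [Module S M] [AddCommGroup N] [Module S N] : ModuleCat S :=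
  ((Ext S (ModuleCat S) i).obj (op (ModuleCat.of S M))).obj (ModuleCat.of S N)

/-- Tor^S_i(M, N) as a module. -/
noncomputable abbrev torMod (S : Type u) [CommRing S] (i : ℕ)
    (M N : Type u) [AddCommGroup M] [Module S M] [AddCommGroup N] [Module S N] : ModuleCat S :=
  ((Tor (ModuleCat S) i).obj (ModuleCat.of S M)).obj (ModuleCat.of S N)

/-- The projective dimension of a module, characterized as the least `n` such that
`Ext_S^i(M, -)` vanishes for all `i > n` (equal to `⊤` if there is no such `n`). -/
noncomputable def projDim (S : Type u) [CommRing S]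
    (M : Type u) [AddCommGroup M] [Module S M] : ℕ∞ :=
  sInf {n : ℕ∞ | ∀ i : ℕ, n < i → ∀ (N : Type u) [AddCommGroup N] [Module S N],
    Subsingleton (extMod S i M N)}

open TensorProduct

section
variable {R M : Type*} [CommRing R] [AddCommGroup M] [Module R M]

variable (R M) in
/-- The evaluation map `M ⊗ B → Hom(Hom(B, R), M)`, sending `m ⊗ b` to `φ ↦ φ b • m`. -/
noncomputable def tensorToHomDual (B : Type*) [AddCommGroup B] [Module R B] :
    M ⊗[R] B →ₗ[R] Module.Dual R B →ₗ[R] M :=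
  dualTensorHom R (Module.Dual R B) M ∘ₗ (Module.Dual.eval R B).rTensor M ∘ₗ
    (TensorProduct.comm R M B).toLinearMap

@[simp]
lemma tensorToHomDual_tmul {B : Type*} [AddCommGroup B] [Module R B] (m : M) (b : B)
    (φ : Module.Dual R B) : tensorToHomDual R M B (m ⊗ₜ b) φ = φ b • m := by
  simp [tensorToHomDual]

lemma tensorToHomDual_lTensor {B C : Type*} [AddCommGroup B] [Module R B] [AddCommGroup C]
    [Module R C] (g : B →ₗ[R] C) (t : M ⊗[R] B) (ψ : Module.Dual R C) :
    tensorToHomDual R M C (g.lTensor M t) ψ = tensorToHomDual R M B t (ψ ∘ₗ g) := by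
  induction t with
  | zero => simp
  | tmul m b => simp
  | add x y hx hy => simp [hx, hy]

lemma tensorToHomDual_bijective (B : Type*) [AddCommGroup B] [Module R B] [Module.Finite R B]
    [Module.Projective R B] : Function.Bijective (tensorToHomDual R M B) := by
  have h : Function.Bijective ((Module.Dual.eval R B).rTensor M) :=
    ((Module.evalEquiv R B).rTensor M).bijective
  rw [tensorToHomDual, LinearMap.coe_comp, LinearMap.coe_comp]
  exact dualTensorHom_bijective.comp (h.comp (TensorProduct.comm R M B).bijective)

variable {A B C W E Z T : Type*} [AddCommGroup A] [Module R A] [AddCommGroup B] [Module R B]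
  [AddCommGroup C] [Module R C] [AddCommGroup W] [Module R W] [AddCommGroup E] [Module R E]
  [AddCommGroup Z] [Module R Z] [AddCommGroup T] [Module R T]

/-- Let `A → B → C` be a complex of modules with `B` and `C` finite projective and `B / im A`
projective. If `E` is the homology of `Hom(C, R) → Hom(B, R) → Hom(A, R)` and `T` is the homology
of `M ⊗ A → M ⊗ B → M ⊗ C`, then `Hom(E, M) ≃ T`. -/
theorem nonempty_hom_linearEquiv_of_projective_quotient
    [Module.Finite R B] [Module.Projective R B] [Module.Finite R C] [Module.Projective R C]
    (f : A →ₗ[R] B) (g : B →ₗ[R] C) (hfg : g ∘ₗ f = 0)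
    [Module.Projective R (B ⧸ LinearMap.range f)]
    (c : W →ₗ[R] Module.Dual R B) (hc : ∀ φ, (∃ w, c w = φ) ↔ φ ∘ₗ f = 0)
    (q : W →ₗ[R] E) (hq : Function.Surjective q)
    (hq0 : ∀ w, q w = 0 ↔ ∃ ψ : Module.Dual R C, ψ ∘ₗ g = c w)
    (i : Z →ₗ[R] M ⊗[R] B) (hi : ∀ t, (∃ z, i z = t) ↔ g.lTensor M t = 0)
    (p : Z →ₗ[R] T) (hp : Function.Surjective p)
    (hp0 : ∀ z, p z = 0 ↔ ∃ s, f.lTensor M s = i z) :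
    Nonempty ((E →ₗ[R] M) ≃ₗ[R] T) := by
  let π := (LinearMap.range f).mkQ
  let α : (E →ₗ[R] M) →ₗ[R] W →ₗ[R] M := LinearMap.lcomp R M q
  have hα : Function.Injective α := fun h h' hh ↦ by
    ext x
    obtain ⟨w, rfl⟩ := hq x
    exact congr($hh w)
  let β : Z →ₗ[R] W →ₗ[R] M := (LinearMap.lcomp R M c) ∘ₗ tensorToHomDual R M B ∘ₗ i
  have hβ_apply (z w) : β z w = tensorToHomDual R M B (i z) (c w) := rfl
  have factor (φ : Module.Dual R B) (hφ : φ ∘ₗ f = 0) :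
      ∃ ψ : Module.Dual R (B ⧸ LinearMap.range f), ψ ∘ₗ π = φ :=
    ⟨(LinearMap.range f).liftQ φ (LinearMap.range_le_ker_iff.2 hφ), Submodule.liftQ_mkQ _ _ _⟩
  have hπf : π ∘ₗ f = 0 := LinearMap.range_mkQ_comp f
  have hexact : Function.Exact (f.lTensor M) (π.lTensor M) :=
    lTensor_exact M (LinearMap.exact_map_mkQ_range f) (Submodule.mkQ_surjective _)
  have ker_eq : LinearMap.ker p = LinearMap.ker β := by
    ext z
    rw [LinearMap.mem_ker, LinearMap.mem_ker, hp0]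
    constructor
    · rintro ⟨s, hs⟩
      ext w
      rw [hβ_apply, ← hs, tensorToHomDual_lTensor, (hc _).1 ⟨w, rfl⟩]
      simp
    · intro hz
      refine (hexact _).1 ((tensorToHomDual_bijective (R := R) (M := M) _).1 ?_)
      ext ψ
      obtain ⟨w, hw⟩ := (hc (ψ ∘ₗ π)).2 (by rw [LinearMap.comp_assoc, hπf, LinearMap.comp_zero])
      rw [tensorToHomDual_lTensor, ← hw, ← hβ_apply, hz]
      simp
  have range_eq : LinearMap.range α = LinearMap.range β := by
    apply le_antisymm
    · rintro _ ⟨h, rfl⟩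
      have hc' (ψ : Module.Dual R (B ⧸ LinearMap.range f)) : ψ ∘ₗ π ∈ LinearMap.range c :=
        (hc _).2 (by rw [LinearMap.comp_assoc, hπf, LinearMap.comp_zero])
      have ker_le : LinearMap.ker c ≤ LinearMap.ker (h ∘ₗ q) := fun w hw ↦ by
        have : q w = 0 := (hq0 w).2 ⟨0, by rw [LinearMap.zero_comp]; exact hw.symm⟩
        simp [this]
      obtain ⟨k, hk⟩ : ∃ k : LinearMap.range c →ₗ[R] M, ∀ w, k ⟨c w, ⟨w, rfl⟩⟩ = h (q w) :=
        ⟨(LinearMap.ker c).liftQ _ ker_le ∘ₗ c.quotKerEquivRange.symm.toLinearMap, fun w ↦ by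
          have : (⟨c w, ⟨w, rfl⟩⟩ : LinearMap.range c) =
            c.quotKerEquivRange (Submodule.Quotient.mk w) := rfl
          rw [this]; simp⟩
      obtain ⟨s, hs⟩ := (tensorToHomDual_bijective (R := R) (M := M) _).2
        (k ∘ₗ LinearMap.codRestrict (LinearMap.range c) (LinearMap.lcomp R R π) hc')
      obtain ⟨t, rfl⟩ := LinearMap.lTensor_surjective M (Submodule.mkQ_surjective _) s
      have ht (w) : tensorToHomDual R M B t (c w) = h (q w) := by
        obtain ⟨ψ, hψ⟩ := factor (c w) ((hc _).1 ⟨w, rfl⟩)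
        have := congr($hs ψ)
        rw [tensorToHomDual_lTensor] at this
        rw [← hψ, this, ← hk]
        simp only [← hψ]
        rfl
      obtain ⟨z, rfl⟩ := (hi t).2 <| (tensorToHomDual_bijective (R := R) (M := M) _).1 <| by
        ext ψ
        obtain ⟨w, hw⟩ := (hc (ψ ∘ₗ g)).2 (by rw [LinearMap.comp_assoc, hfg, LinearMap.comp_zero])
        rw [tensorToHomDual_lTensor, ← hw, ht, (hq0 w).2 ⟨ψ, hw.symm⟩]
        simp
      exact ⟨z, LinearMap.ext ht⟩
    · rintro _ ⟨z, rfl⟩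
      have ker_le : LinearMap.ker q ≤ LinearMap.ker (β z) := fun w hw ↦ by
        obtain ⟨ψ, hψ⟩ := (hq0 w).1 hw
        rw [LinearMap.mem_ker, hβ_apply, ← hψ, ← tensorToHomDual_lTensor, (hi _).1 ⟨z, rfl⟩]
        simp
      refine ⟨(LinearMap.ker q).liftQ _ ker_le ∘ₗ
        (q.quotKerEquivOfSurjective hq).symm.toLinearMap, LinearMap.ext fun w ↦ ?_⟩
      have : q w = q.quotKerEquivOfSurjective hq (Submodule.Quotient.mk w) := rfl
      change (LinearMap.ker q).liftQ _ ker_le ((q.quotKerEquivOfSurjective hq).symm (q w)) = _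
      rw [this]; simp
  exact ⟨(LinearEquiv.ofInjective α hα).trans <| (LinearEquiv.ofEq _ _ range_eq).trans <|
    β.quotKerEquivRange.symm.trans <| (Submodule.quotEquivOfEq _ _ ker_eq.symm).trans <|
    p.quotKerEquivOfSurjective hp⟩
end

namespace CategoryTheory.ProjectiveResolution

section

variable {C : Type*} [Category* C] [Abelian C] {K P : ℕ → C} (π : ∀ n, P n ⟶ K n)
  (ι : ∀ n, K (n + 1) ⟶ P n) (w : ∀ n, ι n ≫ π n = 0)

/-- The complex obtained by splicing the sequences `K (n + 1) ⟶ P n ⟶ K n`. -/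
noncomputable def spliceComplex : ChainComplex C ℕ :=
  ChainComplex.of P (fun n ↦ π (n + 1) ≫ ι n) (fun n ↦ by simp [reassoc_of% (w (n + 1))])

lemma spliceComplex_d (n : ℕ) : (spliceComplex π ι w).d (n + 1) n = π (n + 1) ≫ ι n :=
  ChainComplex.of_d P (fun n ↦ π (n + 1) ≫ ι n) n

variable [∀ n, Epi (π n)] (hex : ∀ n, (ShortComplex.mk _ _ (w n)).Exact)

include hex in
lemma exact_splice (n : ℕ) :
    (ShortComplex.mk (π (n + 1) ≫ ι n) (π n) (by simp [w])).Exact := by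
  let α : ShortComplex.mk (π (n + 1) ≫ ι n) (π n) (by simp [w]) ⟶ ShortComplex.mk _ _ (w n) :=
    { τ₁ := π (n + 1)
      τ₂ := 𝟙 _
      τ₃ := 𝟙 _ }
  exact (ShortComplex.exact_iff_of_epi_of_isIso_of_mono α).2 (hex n)

variable [∀ n, Mono (ι n)]

include hex in
lemma spliceComplex_exactAt_succ (n : ℕ) : (spliceComplex π ι w).ExactAt (n + 1) := by
  rw [HomologicalComplex.exactAt_iff' _ (n + 1 + 1) (n + 1) n (by simp) (by simp)]
  let α : ShortComplex.mk (π (n + 1 + 1) ≫ ι (n + 1)) (π (n + 1)) (by simp [w]) ⟶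
      (spliceComplex π ι w).sc' (n + 1 + 1) (n + 1) n :=
    { τ₁ := 𝟙 (P _)
      τ₂ := 𝟙 (P _)
      τ₃ := ι n
      comm₁₂ := (Category.id_comp _).trans
        ((spliceComplex_d π ι w (n + 1)).trans (Category.comp_id _).symm)
      comm₂₃ := (Category.id_comp _).trans (spliceComplex_d π ι w n) }
  have : Epi α.τ₁ := inferInstanceAs (Epi (𝟙 (P _)))
  have : IsIso α.τ₂ := inferInstanceAs (IsIso (𝟙 (P _)))
  have : Mono α.τ₃ := inferInstanceAs (Mono (ι n))
  exact (ShortComplex.exact_iff_of_epi_of_isIso_of_mono α).1 (exact_splice π ι w hex (n + 1))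

/-- The projective resolution obtained by splicing short exact sequences
`0 ⟶ K (n + 1) ⟶ P n ⟶ K n ⟶ 0` with `P n` projective. -/
noncomputable def splice [∀ n, Projective (P n)] : ProjectiveResolution (K 0) where
  complex := spliceComplex π ι w
  projective n := inferInstanceAs (Projective (P n))
  π := (ChainComplex.toSingle₀Equiv _ _).symm ⟨π 0, by
    rw [spliceComplex_d]
    exact (Category.assoc _ _ _).trans ((congrArg (π 1 ≫ ·) (w 0)).trans Limits.comp_zero)⟩
  quasiIso := ⟨fun n ↦ by
    cases n
    · rw [ChainComplex.quasiIsoAt₀_iff, ShortComplex.quasiIso_iff_of_zeros']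
      · refine (ShortComplex.exact_and_epi_g_iff_of_iso ?_).2
          ⟨exact_splice π ι w hex 0, inferInstanceAs (Epi (π 0))⟩
        exact ShortComplex.isoMk (Iso.refl _) (Iso.refl _) (Iso.refl _)
          ((Category.id_comp _).trans
            ((spliceComplex_d π ι w 0).symm.trans (Category.comp_id _).symm))
          ((Category.id_comp _).trans ((ChainComplex.toSingle₀Equiv_symm_apply_f_zero
            (C := spliceComplex π ι w) (π 0) _).symm.trans (Category.comp_id _).symm))
      all_goals rfl
    · rw [quasiIsoAt_iff_exactAt']
      · exact spliceComplex_exactAt_succ π ι w hex _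
      · apply ChainComplex.exactAt_succ_single_obj⟩

end

/-- A finite module over a Noetherian ring has a projective resolution by finite modules. -/
theorem exists_finite {S : Type u} [CommRing S] [IsNoetherianRing S]
    (M : ModuleCat.{u} S) [hM : Module.Finite S M] :
    ∃ P : ProjectiveResolution M, ∀ n, Module.Finite S (P.complex.X n) := by
  have step (N : {N : ModuleCat.{u} S // Module.Finite S N}) :
      ∃ (N' : {N : ModuleCat.{u} S // Module.Finite S N}) (F : ModuleCat.{u} S)
        (ι : N'.1 ⟶ F) (π : F ⟶ N.1) (w : ι ≫ π = 0), Module.Finite S F ∧ Projective F ∧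
          Mono ι ∧ Epi π ∧ (ShortComplex.mk ι π w).Exact := by
    obtain ⟨N, hN⟩ := N
    obtain ⟨n, f, hf⟩ := Module.Finite.exists_fin' S N
    have hse := LinearMap.shortExact_shortComplexKer hf
    exact ⟨⟨ModuleCat.of S (LinearMap.ker f), inferInstanceAs (Module.Finite S (LinearMap.ker f))⟩,
      ModuleCat.of S (Fin n → S), f.shortComplexKer.f, f.shortComplexKer.g, f.shortComplexKer.zero,
      inferInstanceAs (Module.Finite S (Fin n → S)),
      (IsProjective.iff_projective (Fin n → S)).1 inferInstance,
      hse.mono_f, hse.epi_g, hse.exact⟩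
  choose N' F ι π w hfin hproj hmono hepi hex using step
  let K : ℕ → {N : ModuleCat.{u} S // Module.Finite S N} := Nat.rec ⟨M, hM⟩ fun _ ↦ N'
  have (n : ℕ) : Epi (π (K n)) := hepi _
  have (n : ℕ) : Mono (ι (K n)) := hmono _
  have (n : ℕ) : Projective (F (K n)) := hproj _
  exact ⟨splice (K := fun n ↦ (K n).1) (fun n ↦ π (K n)) (fun n ↦ ι (K n)) (fun n ↦ w (K n))
    (fun n ↦ hex (K n)), fun n ↦ hfin (K n)⟩

end CategoryTheory.ProjectiveResolution

lemma subsingleton_extMod_of_projDim_lt {S : Type u} [CommRing S] {M : Type u} [AddCommGroup M]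
    [Module S M] {i : ℕ} (h : projDim S M < i) (N : Type u) [AddCommGroup N] [Module S N] :
    Subsingleton (extMod S i M N) := by
  obtain ⟨n, hn, hni⟩ := sInf_lt_iff.1 h
  exact hn i hni N

lemma CategoryTheory.ShortComplex.exists_moduleCat_ker_to_homology {R : Type*} [Ring R]
    (T : ShortComplex (ModuleCat R)) :
    ∃ q : LinearMap.ker T.g.hom →ₗ[R] T.homology, Function.Surjective q ∧
      ∀ w, q w = 0 ↔ ∃ x, T.f.hom x = w := by
  let φ : (LinearMap.ker T.g.hom ⧸ LinearMap.range T.moduleCatToCycles) ≃ₗ[R] T.homology :=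
    T.moduleCatHomologyIso.toLinearEquiv.symm
  refine ⟨φ.toLinearMap ∘ₗ (LinearMap.range T.moduleCatToCycles).mkQ,
    φ.surjective.comp (Submodule.mkQ_surjective _), fun w ↦ ?_⟩
  rw [LinearMap.comp_apply, LinearEquiv.coe_coe, LinearEquiv.map_eq_zero_iff, Submodule.mkQ_apply,
    Submodule.Quotient.mk_eq_zero]
  exact exists_congr fun x ↦ Subtype.ext_iff

/-- If the `(n + 1)`-st cohomology of `P` with coefficients in `im (P_{n + 1} ⟶ P_n)` vanishes and
`P_n` is projective, then `P_n / im P_{n + 1}` is projective. -/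
theorem projective_quotient_of_subsingleton_homology {S : Type u} [CommRing S]
    (P : ChainComplex (ModuleCat.{u} S) ℕ) (n : ℕ) [Module.Projective S (P.X n)]
    (h : Subsingleton ((P.linearYonedaObj S
      (ModuleCat.of S (LinearMap.range (P.d (n + 1) n).hom))).homology (n + 1))) :
    Module.Projective S (P.X n ⧸ LinearMap.range (P.d (n + 1) n).hom) := by
  let Z := ModuleCat.of S (LinearMap.range (P.d (n + 1) n).hom)
  have hex : (P.linearYonedaObj S Z).ExactAt (n + 1) := by
    rw [HomologicalComplex.exactAt_iff_isZero_homology]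
    exact ModuleCat.isZero_of_subsingleton _
  rw [HomologicalComplex.exactAt_iff' _ n (n + 1) (n + 1 + 1) (by simp) (by simp),
    ShortComplex.moduleCat_exact_iff] at hex
  let p : P.X (n + 1) ⟶ Z := ModuleCat.ofHom (P.d (n + 1) n).hom.rangeRestrict
  obtain ⟨r, hr⟩ : ∃ r : P.X n ⟶ Z, P.d (n + 1) n ≫ r = p := hex p <| by
    change P.d (n + 1 + 1) (n + 1) ≫ p = 0
    ext x
    exact congr($(P.d_comp_d (n + 1 + 1) (n + 1) n) x)
  let s : P.X n ⧸ LinearMap.range (P.d (n + 1) n).hom →ₗ[S] P.X n :=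
    (LinearMap.range (P.d (n + 1) n).hom).liftQ (LinearMap.id - Submodule.subtype _ ∘ₗ r.hom) <| by
      rintro _ ⟨x, rfl⟩
      exact sub_eq_zero.2 congr(($hr x).1).symm
  refine Module.Projective.of_split s (Submodule.mkQ _) (Submodule.linearMap_qext _ ?_)
  ext x
  exact (Submodule.Quotient.eq _).2 (by simp [s])

open ShortComplex in
theorem nonempty_hom_homology_linearEquiv {S : Type u} [CommRing S]
    (M : Type u) {A B C : Type u} [AddCommGroup M] [Module S M]
    [AddCommGroup A] [Module S A] [AddCommGroup B] [Module S B] [AddCommGroup C] [Module S C]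
    [Module.Finite S B] [Module.Projective S B] [Module.Finite S C] [Module.Projective S C]
    (f : A →ₗ[S] B) (g : B →ₗ[S] C) (hfg : g ∘ₗ f = 0)
    [Module.Projective S (B ⧸ LinearMap.range f)] :
    Nonempty (((moduleCatMk (LinearMap.lcomp S S g) (LinearMap.lcomp S S f)
        (by ext φ x; exact (congr(φ ($hfg x))).trans (map_zero φ))).homology →ₗ[S] M) ≃ₗ[S]
      (moduleCatMk (f.lTensor M) (g.lTensor M)
        (by rw [← LinearMap.lTensor_comp, hfg, LinearMap.lTensor_zero])).homology) := by
  obtain ⟨q, hq, hq0⟩ := (moduleCatMk (LinearMap.lcomp S S g) (LinearMap.lcomp S S f)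
    (by ext φ x; exact (congr(φ ($hfg x))).trans (map_zero φ))).exists_moduleCat_ker_to_homology
  obtain ⟨p, hp, hp0⟩ := (moduleCatMk (f.lTensor M) (g.lTensor M)
    (by rw [← LinearMap.lTensor_comp, hfg,
      LinearMap.lTensor_zero])).exists_moduleCat_ker_to_homology
  let c : LinearMap.ker (LinearMap.lcomp S S f) →ₗ[S] Module.Dual S B := Submodule.subtype _
  let i : LinearMap.ker (g.lTensor M) →ₗ[S] M ⊗[S] B := Submodule.subtype _
  exact nonempty_hom_linearEquiv_of_projective_quotient
    (W := LinearMap.ker (LinearMap.lcomp S S f)) (Z := LinearMap.ker (g.lTensor M)) f g hfg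
    c (fun φ ↦ ⟨fun ⟨z, hz⟩ ↦ hz ▸ z.2, fun h ↦ ⟨⟨φ, h⟩, rfl⟩⟩) q hq hq0
    i (fun t ↦ ⟨fun ⟨z, hz⟩ ↦ hz ▸ z.2, fun h ↦ ⟨⟨t, h⟩, rfl⟩⟩) p hp hp0

/-- If `P` is a complex of finite projective modules and `P_e / im P_{e + 1}` is projective, then
`Hom(H^e(Hom(P, S)), M) ≃ H_e(M ⊗ P)`. -/
theorem nonempty_hom_homology_linearYonedaObj_linearEquiv {S : Type u} [CommRing S]
    (M : Type u) [AddCommGroup M] [Module S M]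
    (P : ChainComplex (ModuleCat.{u} S) ℕ) [∀ n, Module.Projective S (P.X n)]
    [∀ n, Module.Finite S (P.X n)] (e : ℕ)
    [Module.Projective S (P.X e ⧸ LinearMap.range (P.d (e + 1) e).hom)] :
    Nonempty (((P.linearYonedaObj S (ModuleCat.of S S)).homology e →ₗ[S] M) ≃ₗ[S]
      ((((MonoidalCategory.tensoringLeft (ModuleCat.{u} S)).obj
        (ModuleCat.of S M)).mapHomologicalComplex _).obj P).homology e) := by
  have : Module.Projective S
      (P.X e ⧸ LinearMap.range (P.d ((ComplexShape.down ℕ).prev e) e).hom) := by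
    rwa [ChainComplex.prev]
  have hd : (P.d e ((ComplexShape.down ℕ).next e)).hom ∘ₗ
      (P.d ((ComplexShape.down ℕ).prev e) e).hom = 0 := by
    rw [← ModuleCat.hom_comp, P.d_comp_d]; rfl
  obtain ⟨φ⟩ := nonempty_hom_homology_linearEquiv M (P.d ((ComplexShape.down ℕ).prev e) e).hom
    (P.d e ((ComplexShape.down ℕ).next e)).hom hd
  let ψ := ShortComplex.homologyMapIso (S₁ := (P.linearYonedaObj S (ModuleCat.of S S)).sc e)
    (ShortComplex.isoMk (S₂ := ShortComplex.moduleCatMk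
      (LinearMap.lcomp S S (P.d e ((ComplexShape.down ℕ).next e)).hom)
      (LinearMap.lcomp S S (P.d ((ComplexShape.down ℕ).prev e) e).hom)
      (by ext φ x; exact (congr(φ ($hd x))).trans (map_zero φ)))
      (LinearEquiv.toModuleIso (ModuleCat.homLinearEquiv (S := S)))
      (LinearEquiv.toModuleIso (ModuleCat.homLinearEquiv (S := S)))
      (LinearEquiv.toModuleIso (ModuleCat.homLinearEquiv (S := S))) rfl rfl)
  exact ⟨(LinearEquiv.congrLeft M S ψ.toLinearEquiv).trans φ⟩

/-- Let `(S, m)` be a commutative Noetherian local ring and `M` a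
nonzero finitely generated `S`-module of finite projective dimension `e`. Then there
is an `S`-module isomorphism `Hom_S(Ext_S^e(M, S), M) ≅ Tor^S_e(M, M)`; in particular
`Hom_S(Ext_S^e(M, S), M) ≠ 0` if and only if `Tor^S_e(M, M) ≠ 0`. -/
theorem hom_ext_linearEquiv_tor (S : Type u) [CommRing S] [IsLocalRing S]
    [IsNoetherianRing S] (M : Type u) [AddCommGroup M] [Module S M]
    [Module.Finite S M] [Nontrivial M] (e : ℕ) (he : projDim S M = (e : ℕ∞)) :
    Nonempty (((extMod S e M S) →ₗ[S] M) ≃ₗ[S] (torMod S e M M)) ∧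
      (Nontrivial ((extMod S e M S) →ₗ[S] M) ↔ Nontrivial (torMod S e M M)) := by
  obtain ⟨P, hP⟩ := ProjectiveResolution.exists_finite (ModuleCat.of S M)
  have hproj (n : ℕ) : Module.Projective S (P.complex.X n) :=
    (IsProjective.iff_projective _).2 (P.projective n)
  have hsub (N : Type u) [AddCommGroup N] [Module S N] :
      Subsingleton ((P.complex.linearYonedaObj S (ModuleCat.of S N)).homology (e + 1)) :=
    have := subsingleton_extMod_of_projDim_lt (i := e + 1)
      (he ▸ Nat.cast_lt.2 e.lt_succ_self : projDim S M < _) N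
    (P.isoExt (e + 1) (ModuleCat.of S N)).toLinearEquiv.symm.toEquiv.subsingleton
  have := projective_quotient_of_subsingleton_homology P.complex e (hsub _)
  obtain ⟨φ⟩ := nonempty_hom_homology_linearYonedaObj_linearEquiv M P.complex e
  let ψ : ((extMod S e M S) →ₗ[S] M) ≃ₗ[S] (torMod S e M M) :=
    (LinearEquiv.congrLeft M S (P.isoExt e (ModuleCat.of S S)).toLinearEquiv).trans <|
      φ.trans (P.isoLeftDerivedObj ((MonoidalCategory.tensoringLeft _).obj
        (ModuleCat.of S M)) e).toLinearEquiv.symm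
  exact ⟨⟨ψ⟩, ψ.toEquiv.nontrivial_congr⟩
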